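/- Let f : ℝⁿ → ℝ be differentiable with L-Lipschitz continuous gradient (L > 0), let θ > 0 and λ > 0, let x ∈ ℝⁿ, and let B ⊆ {1,…,n} be an index set. Suppose x⁺ is a global minimizer of the map z ↦ f(z) + λ‖z‖₀ + (θ/2)‖z − x‖₂² over the set {z ∈ ℝⁿ : z_i = x_i for every i ∉ B}. Then every index i ∈ B with x⁺_i ≠ 0 satisfies |x⁺_i| ≥ √(2λ/(θ + L)). -/

import Mathlib

open Classical in
/-- Number of nonzero components of a vector (the ℓ₀ pseudo-norm). -/
noncomputable def norm0 {n : ℕ} (x : EuclideanSpace ℝ (Fin n)) : ℕ :=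
  (Finset.univ.filter fun i => x i ≠ 0).card

open scoped InnerProductSpace

/-- The descent lemma: quadratic upper bound for a function with Lipschitz gradient. -/
lemma descent_lemma {E : Type*} [NormedAddCommGroup E] [InnerProductSpace ℝ E] [CompleteSpace E]
    {f : E → ℝ} {f' : E → E} (hgrad : ∀ y, HasGradientAt f (f' y) y)
    {K : NNReal} (hlip : LipschitzWith K f') (y v : E) :
    f (y + v) ≤ f y + ⟪f' y, v⟫_ℝ + K / 2 * ‖v‖ ^ 2 := by
  have hline (t : ℝ) : HasDerivAt (fun t : ℝ => f (y + t • v)) ⟪f' (y + t • v), v⟫_ℝ t := by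
    have h : HasDerivAt (fun t : ℝ => y + t • v) v t := by
      simpa using ((hasDerivAt_id t).smul_const v).const_add y
    simpa [Function.comp_def] using (hgrad (y + t • v)).hasFDerivAt.comp_hasDerivAt t h
  have hderiv (t : ℝ) :
      HasDerivAt (fun t : ℝ => f (y + t • v) - t * ⟪f' y, v⟫_ℝ - K / 2 * ‖v‖ ^ 2 * t ^ 2)
        (⟪f' (y + t • v), v⟫_ℝ - ⟪f' y, v⟫_ℝ - K * ‖v‖ ^ 2 * t) t := by
    refine (((hline t).sub ((hasDerivAt_id t).mul_const ⟪f' y, v⟫_ℝ)).sub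
      ((hasDerivAt_pow 2 t).const_mul (K / 2 * ‖v‖ ^ 2))).congr_deriv ?_
    norm_num
    ring
  have hanti : AntitoneOn
      (fun t : ℝ => f (y + t • v) - t * ⟪f' y, v⟫_ℝ - K / 2 * ‖v‖ ^ 2 * t ^ 2) (Set.Ici 0) := by
    refine antitoneOn_of_deriv_nonpos (convex_Ici 0)
      (fun t _ => (hderiv t).continuousAt.continuousWithinAt)
      (fun t _ => (hderiv t).differentiableAt.differentiableWithinAt) fun t ht => ?_
    rw [interior_Ici, Set.mem_Ioi] at ht
    rw [(hderiv t).deriv, ← inner_sub_left, sub_nonpos]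
    have hd : ‖f' (y + t • v) - f' y‖ ≤ K * (t * ‖v‖) := by
      simpa [norm_smul, abs_of_pos ht] using hlip.norm_sub_le (y + t • v) y
    calc ⟪f' (y + t • v) - f' y, v⟫_ℝ ≤ ‖f' (y + t • v) - f' y‖ * ‖v‖ := real_inner_le_norm _ _
      _ ≤ K * (t * ‖v‖) * ‖v‖ := by gcongr
      _ = K * ‖v‖ ^ 2 * t := by ring
  have h := hanti (Set.mem_Ici.2 le_rfl) (Set.mem_Ici.2 zero_le_one) zero_le_one
  simp only [one_smul, zero_smul, add_zero] at h
  linarith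

/-- A quadratic without constant term that is nonnegative everywhere has no linear term. -/
lemma eq_zero_of_forall_linear_add_quadratic_nonneg {b a : ℝ}
    (h : ∀ t : ℝ, 0 ≤ t * b + t ^ 2 * a) : b = 0 := by
  have hdisc : discrim a b 0 ≤ 0 := discrim_le_zero fun t => by linarith [h t]
  simpa [discrim, sq_nonpos_iff] using hdisc

lemma norm0_add_smul_single_le {n : ℕ} (y : EuclideanSpace ℝ (Fin n)) {i : Fin n}
    (hi : y i ≠ 0) (t : ℝ) :
    norm0 (y + t • EuclideanSpace.single i (y i)) ≤ norm0 y := by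
  unfold norm0
  refine Finset.card_le_card fun j hj => ?_
  rw [Finset.mem_filter] at hj ⊢
  refine ⟨hj.1, ?_⟩
  rcases eq_or_ne j i with rfl | hji
  · exact hi
  · simpa [hji] using hj.2

lemma norm0_sub_single_lt {n : ℕ} (y : EuclideanSpace ℝ (Fin n)) {i : Fin n} (hi : y i ≠ 0) :
    norm0 (y - EuclideanSpace.single i (y i)) < norm0 y := by
  unfold norm0
  refine Finset.card_lt_card (Finset.ssubset_iff_of_subset (fun j hj => ?_) |>.2 ⟨i, ?_, ?_⟩)
  · rw [Finset.mem_filter] at hj ⊢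
    refine ⟨hj.1, ?_⟩
    rcases eq_or_ne j i with rfl | hji
    · exact hi
    · simpa [hji] using hj.2
  · simpa using hi
  · simp

/-- Theorem 2(a), core claim: every nonzero entry (within the working set) of the
solution of the proximal block subproblem for the sparse regularized problem has
magnitude at least `√(2λ/(θ+L))`. -/
theorem nonzero_magnitude_bound {n : ℕ} (f : EuclideanSpace ℝ (Fin n) → ℝ)
    (f' : EuclideanSpace ℝ (Fin n) → EuclideanSpace ℝ (Fin n))
    (hgrad : ∀ y, HasGradientAt f (f' y) y)
    (L : ℝ) (hL : 0 < L) (hlip : LipschitzWith (Real.toNNReal L) f')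
    (θ lam : ℝ) (hθ : 0 < θ) (hlam : 0 < lam)
    (x xp : EuclideanSpace ℝ (Fin n)) (B : Finset (Fin n))
    (hfeas : ∀ i ∉ B, xp i = x i)
    (hmin : ∀ z : EuclideanSpace ℝ (Fin n), (∀ i ∉ B, z i = x i) →
      f xp + lam * norm0 xp + θ / 2 * ‖xp - x‖ ^ 2 ≤
        f z + lam * norm0 z + θ / 2 * ‖z - x‖ ^ 2) :
    ∀ i ∈ B, xp i ≠ 0 → Real.sqrt (2 * lam / (θ + L)) ≤ |xp i| := by
  intro i hi hxi
  set v : EuclideanSpace ℝ (Fin n) := EuclideanSpace.single i (xp i) with hv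
  have hnorm : ‖v‖ ^ 2 = xp i ^ 2 := by simp [hv]
  set b : ℝ := ⟪f' xp, v⟫_ℝ + θ * ⟪xp - x, v⟫_ℝ with hb
  have hcompare (t : ℝ) : lam * norm0 xp ≤
      lam * norm0 (xp + t • v) + (t * b + t ^ 2 * ((θ + L) / 2 * xp i ^ 2)) := by
    have hm := hmin (xp + t • v) fun j hj => by
      have hji : j ≠ i := fun h => hj (h ▸ hi)
      simpa [hv, hji] using hfeas j hj
    have hd := descent_lemma hgrad hlip xp (t • v)
    have hsq : ‖xp + t • v - x‖ ^ 2 =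
        ‖xp - x‖ ^ 2 + 2 * (t * ⟪xp - x, v⟫_ℝ) + t ^ 2 * xp i ^ 2 := by
      rw [add_sub_right_comm, norm_add_sq_real, real_inner_smul_right, norm_smul, mul_pow, hnorm,
        Real.norm_eq_abs, sq_abs]
    rw [Real.coe_toNNReal L hL.le, real_inner_smul_right, norm_smul, mul_pow, hnorm,
      Real.norm_eq_abs, sq_abs] at hd
    rw [hsq] at hm
    rw [hb]
    linarith
  have hb0 : b = 0 := by
    refine eq_zero_of_forall_linear_add_quadratic_nonneg (a := (θ + L) / 2 * xp i ^ 2) fun t => ?_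
    have hle : (norm0 (xp + t • v) : ℝ) ≤ norm0 xp :=
      mod_cast norm0_add_smul_single_le xp hxi t
    linarith [hcompare t, mul_le_mul_of_nonneg_left hle hlam.le]
  have hlt : (norm0 (xp + (-1 : ℝ) • v) : ℝ) + 1 ≤ norm0 xp := by
    rw [neg_one_smul, ← sub_eq_add_neg]
    exact_mod_cast norm0_sub_single_lt xp hxi
  have hkey := hcompare (-1)
  rw [hb0] at hkey
  refine Real.sqrt_le_iff.2 ⟨abs_nonneg _, ?_⟩
  rw [sq_abs, div_le_iff₀ (by positivity)]
  linarith [mul_le_mul_of_nonneg_left hlt hlam.le]
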